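/- Let a : ℤ² → ℝ be finitely supported, and let f = Σ_{(n1,n2)} a[n1,n2] · 𝟙_{E_{n1,n2}} where E_{n1,n2} = [(n1−1)2^{−n}, n1 2^{−n}] × [(n2−1)2^{−n}, n2 2^{−n}]. Then the total variation norm of the mixed distributional derivative (D⊗D)f equals the ℓ1 norm of the discrete convolution h_{1,1} ∗ a, where h_{1,1} is the 2×2 filter [[1,−1],[−1,1]]: ‖(D⊗D)f‖_M = Σ_{(n1,n2)∈ℤ²} |a[n1,n2] − a[n1+1,n2] − a[n1,n2+1] + a[n1+1,n2+1]|. -/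

import Mathlib

open MeasureTheory Set Filter

noncomputable section

abbrev K2 : Set (ℝ × ℝ) := Icc (0:ℝ) 1 ×ˢ Icc (0:ℝ) 1

def TV (m : SignedMeasure (ℝ × ℝ)) : ℝ := (m.totalVariation univ).toReal

def sInt (m : SignedMeasure (ℝ × ℝ)) (φ : ℝ × ℝ → ℝ) : ℝ :=
  ∫ x, φ x ∂m.toJordanDecomposition.posPart - ∫ x, φ x ∂m.toJordanDecomposition.negPart

def IsTest (φ : ℝ × ℝ → ℝ) : Prop := ContDiff ℝ (⊤ : ℕ∞) φ ∧ HasCompactSupport φ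

def pd1 (φ : ℝ × ℝ → ℝ) : ℝ × ℝ → ℝ := fun x => fderiv ℝ φ x (1, 0)
def pd2 (φ : ℝ × ℝ → ℝ) : ℝ × ℝ → ℝ := fun x => fderiv ℝ φ x (0, 1)

def IsDeriv1 (f : ℝ × ℝ → ℝ) (ν : SignedMeasure (ℝ × ℝ)) : Prop :=
  ∀ φ, IsTest φ → ∫ x, f x * pd1 φ x = - sInt ν φ

def IsDeriv2 (f : ℝ × ℝ → ℝ) (ν : SignedMeasure (ℝ × ℝ)) : Prop :=
  ∀ φ, IsTest φ → ∫ x, f x * pd2 φ x = - sInt ν φ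

def IsMixedDeriv (f : ℝ × ℝ → ℝ) (m : SignedMeasure (ℝ × ℝ)) : Prop :=
  ∀ φ, IsTest φ → ∫ x, f x * pd1 (pd2 φ) x = sInt m φ

def SuppIn (m : SignedMeasure (ℝ × ℝ)) (s : Set (ℝ × ℝ)) : Prop :=
  m.totalVariation sᶜ = 0

def MemM0 (f : ℝ × ℝ → ℝ) (m : SignedMeasure (ℝ × ℝ)) : Prop :=
  IsMixedDeriv f m ∧ SuppIn m K2 ∧ (∀ x ∉ K2, f x = 0) ∧
  (∀ᵐ x : ℝ × ℝ, f x = m (Icc 0 x.1 ×ˢ Icc 0 x.2))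

def Nmix (θ : ℝ) (m ν₁ ν₂ : SignedMeasure (ℝ × ℝ)) : ℝ :=
  θ * TV m + (1 - θ) * (TV ν₁ + TV ν₂)

def ind (A : Set (ℝ × ℝ)) : ℝ × ℝ → ℝ := A.indicator (fun _ => 1)

def h11 (a : ℤ × ℤ → ℝ) (p : ℤ × ℤ) : ℝ :=
  a p - a (p.1 + 1, p.2) - a (p.1, p.2 + 1) + a (p.1 + 1, p.2 + 1)

def h10 (a : ℤ × ℤ → ℝ) (p : ℤ × ℤ) : ℝ := a p - a (p.1 + 1, p.2)

def h01 (a : ℤ × ℤ → ℝ) (p : ℤ × ℤ) : ℝ := a p - a (p.1, p.2 + 1)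

def cell (n : ℕ) (p : ℤ × ℤ) : Set (ℝ × ℝ) :=
  Icc (((p.1 : ℝ) - 1) * (2:ℝ) ^ (-(n:ℤ))) ((p.1 : ℝ) * (2:ℝ) ^ (-(n:ℤ))) ×ˢ
  Icc (((p.2 : ℝ) - 1) * (2:ℝ) ^ (-(n:ℤ))) ((p.2 : ℝ) * (2:ℝ) ^ (-(n:ℤ)))

def pix (n : ℕ) (a : ℤ × ℤ → ℝ) : ℝ × ℝ → ℝ :=
  fun x => ∑' p : ℤ × ℤ, a p * (cell n p).indicator (fun _ => (1:ℝ)) x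

/-- Finite measures on a finite-dimensional space are determined by their integrals against
smooth compactly supported functions. -/
theorem measure_eq_of_integral_contDiff_eq {E : Type*} [NormedAddCommGroup E] [NormedSpace ℝ E]
    [FiniteDimensional ℝ E] [MeasurableSpace E] [BorelSpace E] {μ ν : Measure E}
    [IsFiniteMeasure μ] [IsFiniteMeasure ν]
    (h : ∀ φ : E → ℝ, ContDiff ℝ (⊤ : ℕ∞) φ → HasCompactSupport φ →
      ∫ x, φ x ∂μ = ∫ x, φ x ∂ν) : μ = ν := by
  have hμ : μ ≪ μ + ν := Measure.AbsolutelyContinuous.rfl.add_right ν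
  have hν : ν ≪ μ + ν := by
    rw [add_comm]; exact Measure.AbsolutelyContinuous.rfl.add_right μ
  have iμ : Integrable (fun x => (μ.rnDeriv (μ + ν) x).toReal) (μ + ν) :=
    Measure.integrable_toReal_rnDeriv
  have iν : Integrable (fun x => (ν.rnDeriv (μ + ν) x).toReal) (μ + ν) :=
    Measure.integrable_toReal_rnDeriv
  have key := ae_eq_zero_of_integral_contDiff_smul_eq_zero (iμ.sub iν).locallyIntegrable
    (fun g hg hgc => by
      obtain ⟨C, hC⟩ := hgc.exists_bound_of_continuous hg.continuous
      have e1 := iμ.bdd_mul hg.continuous.aestronglyMeasurable (ae_of_all _ hC)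
      have e2 := iν.bdd_mul hg.continuous.aestronglyMeasurable (ae_of_all _ hC)
      simp only [Pi.sub_apply, smul_eq_mul, mul_sub]
      rw [integral_sub e1 e2]
      have h1 := integral_rnDeriv_smul (f := g) hμ
      have h2 := integral_rnDeriv_smul (f := g) hν
      simp only [smul_eq_mul, mul_comm _ (g _)] at h1 h2
      rw [h1, h2, h g hg hgc, sub_self])
  refine (Measure.withDensity_rnDeriv_eq μ (μ + ν) hμ).symm.trans
    (Eq.trans (withDensity_congr_ae ?_) (Measure.withDensity_rnDeriv_eq ν (μ + ν) hν))
  filter_upwards [key, Measure.rnDeriv_lt_top μ (μ + ν), Measure.rnDeriv_lt_top ν (μ + ν)]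
    with x hx h1 h2
  exact (ENNReal.toReal_eq_toReal_iff' h1.ne h2.ne).1 (sub_eq_zero.1 hx)

/-- The discrete measure with mass `max (w i) 0` at `pt i`, for `i ∈ S`. -/
def atoms {ι α : Type*} [MeasurableSpace α] (S : Finset ι) (pt : ι → α) (w : ι → ℝ) : Measure α :=
  ∑ i ∈ S, ENNReal.ofReal (w i) • Measure.dirac (pt i)

section Atoms

variable {ι α : Type*} [MeasurableSpace α] (S : Finset ι) (pt : ι → α) (w : ι → ℝ)

instance isFiniteMeasure_atoms : IsFiniteMeasure (atoms S pt w) := by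
  refine ⟨?_⟩
  simp [atoms, Measure.finsetSum_apply]

theorem atoms_univ : atoms S pt w univ = ∑ i ∈ S, ENNReal.ofReal (w i) := by
  simp [atoms, Measure.finsetSum_apply]

theorem integral_atoms [MeasurableSingletonClass α] (φ : α → ℝ) :
    ∫ x, φ x ∂(atoms S pt w) = ∑ i ∈ S, max (w i) 0 * φ (pt i) := by
  rw [atoms, integral_finsetSum_measure]
  · simp [integral_smul_measure, ENNReal.toReal_ofReal']
  · intro i _
    exact (integrable_dirac (by simp)).smul_measure ENNReal.ofReal_ne_top

theorem mutuallySingular_atoms_neg [MeasurableSingletonClass α] {pt : ι → α}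
    (hpt : Function.Injective pt) :
    (atoms S pt w).MutuallySingular (atoms S pt (-w)) := by
  have hs : MeasurableSet (pt '' {i | i ∈ S ∧ w i ≤ 0}) :=
    ((S.finite_toSet.subset fun i hi => hi.1).image pt).measurableSet
  refine ⟨pt '' {i | i ∈ S ∧ w i ≤ 0}, hs, ?_, ?_⟩
  · rw [atoms, Measure.finsetSum_apply]
    refine Finset.sum_eq_zero fun i hi => ?_
    rw [Measure.smul_apply, Measure.dirac_apply' _ hs]
    by_cases hw : w i ≤ 0
    · simp [ENNReal.ofReal_of_nonpos hw]
    · simp [hpt.eq_iff, hw]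
  · rw [atoms, Measure.finsetSum_apply]
    refine Finset.sum_eq_zero fun i hi => ?_
    rw [Measure.smul_apply, Measure.dirac_apply' _ hs.compl]
    by_cases hw : w i ≤ 0
    · simp [hpt.eq_iff, hw, hi]
    · simp [ENNReal.ofReal_of_nonpos (show -w i ≤ 0 by linarith)]

end Atoms

theorem isTest_integrable {φ : ℝ × ℝ → ℝ} (hφ : IsTest φ) (μ : Measure (ℝ × ℝ))
    [IsFiniteMeasure μ] : Integrable φ μ :=
  hφ.1.continuous.integrable_of_hasCompactSupport hφ.2

theorem TV_eq_sum_of_sInt_eq_sum {ι : Type*} (m : SignedMeasure (ℝ × ℝ)) (S : Finset ι)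
    {pt : ι → ℝ × ℝ} (hpt : Function.Injective pt) (w : ι → ℝ)
    (h : ∀ φ, IsTest φ → sInt m φ = ∑ i ∈ S, w i * φ (pt i)) :
    TV m = ∑ i ∈ S, |w i| := by
  have key : m.toJordanDecomposition.posPart + atoms S pt (-w) =
      atoms S pt w + m.toJordanDecomposition.negPart := by
    refine measure_eq_of_integral_contDiff_eq fun φ h1 h2 => ?_
    have hφ : IsTest φ := ⟨h1, h2⟩
    rw [integral_add_measure (isTest_integrable hφ _) (isTest_integrable hφ _),
      integral_add_measure (isTest_integrable hφ _) (isTest_integrable hφ _),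
      integral_atoms, integral_atoms]
    have := h φ hφ
    rw [sInt] at this
    have e : ∑ i ∈ S, w i * φ (pt i) =
        ∑ i ∈ S, max (w i) 0 * φ (pt i) - ∑ i ∈ S, max ((-w) i) 0 * φ (pt i) := by
      rw [← Finset.sum_sub_distrib]
      refine Finset.sum_congr rfl fun i _ => ?_
      rw [← sub_mul, Pi.neg_apply, max_zero_sub_max_neg_zero_eq_self]
    linarith
  let J : JordanDecomposition (ℝ × ℝ) :=
    ⟨atoms S pt w, atoms S pt (-w), mutuallySingular_atoms_neg S w hpt⟩
  have hJ : m.toJordanDecomposition = J := by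
    apply SignedMeasure.toJordanDecomposition_eq
    rw [← m.toSignedMeasure_toJordanDecomposition, JordanDecomposition.toSignedMeasure,
      JordanDecomposition.toSignedMeasure, sub_eq_sub_iff_add_eq_add,
      ← Measure.toSignedMeasure_add, ← Measure.toSignedMeasure_add]
    exact Measure.toSignedMeasure_congr key
  rw [TV, SignedMeasure.totalVariation, hJ, Measure.add_apply, atoms_univ, atoms_univ,
    ← Finset.sum_add_distrib, ENNReal.toReal_sum (by simp)]
  refine Finset.sum_congr rfl fun i _ => ?_
  rw [ENNReal.toReal_add ENNReal.ofReal_ne_top ENNReal.ofReal_ne_top, ENNReal.toReal_ofReal',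
    ENNReal.toReal_ofReal', Pi.neg_apply,
    max_zero_add_max_neg_zero_eq_abs_self]

theorem contDiff_pd2 {φ : ℝ × ℝ → ℝ} (hφ : ContDiff ℝ (⊤ : ℕ∞) φ) :
    ContDiff ℝ (⊤ : ℕ∞) (pd2 φ) :=
  (hφ.fderiv_right (m := (⊤ : ℕ∞)) (by simp)).clm_apply contDiff_const

theorem contDiff_pd1 {φ : ℝ × ℝ → ℝ} (hφ : ContDiff ℝ (⊤ : ℕ∞) φ) :
    ContDiff ℝ (⊤ : ℕ∞) (pd1 φ) :=
  (hφ.fderiv_right (m := (⊤ : ℕ∞)) (by simp)).clm_apply contDiff_const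

theorem setIntegral_Icc_pd1 {φ : ℝ × ℝ → ℝ} (hφ : ContDiff ℝ (⊤ : ℕ∞) φ) {a b : ℝ} (hab : a ≤ b)
    (y : ℝ) : ∫ x in Icc a b, pd1 φ (x, y) = φ (b, y) - φ (a, y) := by
  rw [integral_Icc_eq_integral_Ioc, ← intervalIntegral.integral_of_le hab]
  refine intervalIntegral.integral_eq_sub_of_hasDerivAt (f := fun x => φ (x, y)) (fun x _ => ?_) ?_
  · exact ((hφ.differentiable (by simp)) (x, y)).hasFDerivAt.comp_hasDerivAt x
      ((hasDerivAt_id x).prodMk (hasDerivAt_const x y))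
  · exact ((contDiff_pd1 hφ).continuous.comp (by fun_prop)).intervalIntegrable _ _

theorem setIntegral_Icc_pd2 {φ : ℝ × ℝ → ℝ} (hφ : ContDiff ℝ (⊤ : ℕ∞) φ) {c d : ℝ} (hcd : c ≤ d)
    (x : ℝ) : ∫ y in Icc c d, pd2 φ (x, y) = φ (x, d) - φ (x, c) := by
  rw [integral_Icc_eq_integral_Ioc, ← intervalIntegral.integral_of_le hcd]
  refine intervalIntegral.integral_eq_sub_of_hasDerivAt (f := fun y => φ (x, y)) (fun y _ => ?_) ?_
  · exact ((hφ.differentiable (by simp)) (x, y)).hasFDerivAt.comp_hasDerivAt y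
      ((hasDerivAt_const y x).prodMk (hasDerivAt_id y))
  · exact ((contDiff_pd2 hφ).continuous.comp (by fun_prop)).intervalIntegrable _ _

theorem setIntegral_rect_pd1_pd2 {φ : ℝ × ℝ → ℝ} (hφ : ContDiff ℝ (⊤ : ℕ∞) φ) {a b c d : ℝ}
    (hab : a ≤ b) (hcd : c ≤ d) :
    ∫ x in Icc a b ×ˢ Icc c d, pd1 (pd2 φ) x = φ (b, d) - φ (a, d) - φ (b, c) + φ (a, c) := by
  have hi : IntegrableOn (pd1 (pd2 φ)) (Icc a b ×ˢ Icc c d) :=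
    (contDiff_pd1 (contDiff_pd2 hφ)).continuous.continuousOn.integrableOn_compact
      (isCompact_Icc.prod isCompact_Icc)
  have hint : ∀ t, IntegrableOn (fun y => pd2 φ (t, y)) (Icc c d) := fun t =>
    ((contDiff_pd2 hφ).continuous.comp (by fun_prop : Continuous fun y : ℝ => (t, y)))
      |>.continuousOn.integrableOn_compact isCompact_Icc
  rw [IntegrableOn, Measure.volume_eq_prod, ← Measure.prod_restrict] at hi
  rw [Measure.volume_eq_prod, ← Measure.prod_restrict, integral_prod_symm _ hi]
  simp only [setIntegral_Icc_pd1 (contDiff_pd2 hφ) hab]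
  rw [integral_sub (hint b) (hint a), setIntegral_Icc_pd2 hφ hcd, setIntegral_Icc_pd2 hφ hcd]
  ring

/-- The upper right corner of the pixel `cell n p`. -/
def gridPoint (n : ℕ) (p : ℤ × ℤ) : ℝ × ℝ :=
  ((p.1 : ℝ) * (2:ℝ) ^ (-(n:ℤ)), (p.2 : ℝ) * (2:ℝ) ^ (-(n:ℤ)))

theorem gridPoint_injective (n : ℕ) : Function.Injective (gridPoint n) := by
  intro p q h
  have h0 : (2:ℝ) ^ (-(n:ℤ)) ≠ 0 := by positivity
  simp only [gridPoint, Prod.mk.injEq, mul_left_inj' h0, Int.cast_inj] at h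
  exact Prod.ext h.1 h.2

theorem setIntegral_cell_pd1_pd2 {φ : ℝ × ℝ → ℝ} (hφ : ContDiff ℝ (⊤ : ℕ∞) φ) (n : ℕ)
    (p : ℤ × ℤ) :
    ∫ x in cell n p, pd1 (pd2 φ) x = φ (gridPoint n p) - φ (gridPoint n (p - (1, 0)))
      - φ (gridPoint n (p - (0, 1))) + φ (gridPoint n (p - (1, 1))) := by
  have h0 : (0:ℝ) < (2:ℝ) ^ (-(n:ℤ)) := by positivity
  rw [cell, setIntegral_rect_pd1_pd2 hφ (by nlinarith) (by nlinarith)]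
  simp [gridPoint]

theorem integral_pix_mul_pd1_pd2 (n : ℕ) {a : ℤ × ℤ → ℝ} (ha : (Function.support a).Finite)
    {φ : ℝ × ℝ → ℝ} (hφ : ContDiff ℝ (⊤ : ℕ∞) φ) :
    ∫ x, pix n a x * pd1 (pd2 φ) x = ∑' p, a p * (φ (gridPoint n p)
      - φ (gridPoint n (p - (1, 0))) - φ (gridPoint n (p - (0, 1)))
      + φ (gridPoint n (p - (1, 1)))) := by
  have hm : ∀ p, MeasurableSet (cell n p) := fun p => measurableSet_Icc.prod measurableSet_Icc
  have hp : ∀ x, pix n a x * pd1 (pd2 φ) x =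
      ∑ p ∈ ha.toFinset, a p * (cell n p).indicator (pd1 (pd2 φ)) x := by
    intro x
    rw [pix, tsum_eq_sum (s := ha.toFinset), Finset.sum_mul]
    · refine Finset.sum_congr rfl fun p _ => ?_
      by_cases hx : x ∈ cell n p <;> simp [hx]
    · intro p hp
      have : a p = 0 := by simpa using hp
      simp [this]
  simp only [hp]
  rw [integral_finsetSum, tsum_eq_sum (s := ha.toFinset)]
  · refine Finset.sum_congr rfl fun p _ => ?_
    rw [integral_const_mul, integral_indicator (hm p), setIntegral_cell_pd1_pd2 hφ]
  · intro p hp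
    have : a p = 0 := by simpa using hp
    simp [this]
  · intro p _
    refine Integrable.const_mul ((integrable_indicator_iff (hm p)).2 ?_) _
    exact (contDiff_pd1 (contDiff_pd2 hφ)).continuous.continuousOn.integrableOn_compact
      (isCompact_Icc.prod isCompact_Icc)

theorem tsum_mul_shift {a : ℤ × ℤ → ℝ} (ψ : ℤ × ℤ → ℝ) (v : ℤ × ℤ) :
    ∑' p, a p * ψ (p - v) = ∑' p, a (p + v) * ψ p := by
  rw [← (Equiv.addRight v).tsum_eq]
  simp

theorem finite_support_shift {a : ℤ × ℤ → ℝ} (ha : (Function.support a).Finite) (v : ℤ × ℤ) :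
    (Function.support fun p => a (p + v)).Finite :=
  ha.preimage (f := fun p => p + v) (add_left_injective v).injOn

theorem h11_eq (a : ℤ × ℤ → ℝ) (p : ℤ × ℤ) :
    h11 a p = a p - a (p + (1, 0)) - a (p + (0, 1)) + a (p + (1, 1)) := by
  obtain ⟨i, j⟩ := p
  simp [h11]

theorem finite_support_h11 {a : ℤ × ℤ → ℝ} (ha : (Function.support a).Finite) :
    (Function.support (h11 a)).Finite := by
  refine (((ha.union (finite_support_shift ha (1, 0))).union
    (finite_support_shift ha (0, 1))).union (finite_support_shift ha (1, 1))).subset fun p hp => ?_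
  contrapose! hp
  simp only [mem_union, Function.mem_support, not_or, not_not] at hp
  simp [h11_eq, hp]

/-- Summation by parts against the `2 × 2` filter. -/
theorem tsum_mul_mixed_diff {a : ℤ × ℤ → ℝ} (ha : (Function.support a).Finite)
    (ψ : ℤ × ℤ → ℝ) :
    ∑' p, a p * (ψ p - ψ (p - (1, 0)) - ψ (p - (0, 1)) + ψ (p - (1, 1))) =
      ∑' p, h11 a p * ψ p := by
  have hs : ∀ v, Summable fun p => a p * ψ (p - v) := fun v =>
    summable_of_hasFiniteSupport (ha.subset (Function.support_mul_subset_left a _))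
  have hs' : ∀ v, Summable fun p => a (p + v) * ψ p := fun v =>
    summable_of_hasFiniteSupport
      ((finite_support_shift ha v).subset (Function.support_mul_subset_left _ _))
  have h0 : Summable fun p => a p * ψ p := by simpa using hs 0
  simp only [h11_eq, mul_add, mul_sub, add_mul, sub_mul]
  rw [((h0.sub (hs _)).sub (hs _)).tsum_add (hs _), (h0.sub (hs _)).tsum_sub (hs _),
    h0.tsum_sub (hs _), ((h0.sub (hs' _)).sub (hs' _)).tsum_add (hs' _),
    (h0.sub (hs' _)).tsum_sub (hs' _), h0.tsum_sub (hs' _)]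
  simp only [tsum_mul_shift]

theorem stmt11 (n : ℕ) (a : ℤ × ℤ → ℝ) (ha : (Function.support a).Finite)
    (m : SignedMeasure (ℝ × ℝ)) (hm : IsMixedDeriv (pix n a) m) :
    TV m = ∑' p : ℤ × ℤ, |h11 a p| := by
  have hc := finite_support_h11 ha
  rw [TV_eq_sum_of_sInt_eq_sum m hc.toFinset (gridPoint_injective n) (h11 a),
    tsum_eq_sum (s := hc.toFinset)]
  · intro p hp
    have : h11 a p = 0 := by simpa using hp
    simp [this]
  · intro φ hφ
    rw [← hm φ hφ, integral_pix_mul_pd1_pd2 n ha hφ.1,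
      tsum_mul_mixed_diff ha fun p => φ (gridPoint n p), tsum_eq_sum (s := hc.toFinset)]
    intro p hp
    have : h11 a p = 0 := by simpa using hp
    simp [this]
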